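/- Let T be a tree with vertex set V and let u ∈ V be an arbitrary vertex. Then every function f : V → ℝ satisfies Σ_{v∈V} μ_T(u,v) Σ_{w∈T(v)} Σ_{x∈T(w)} f(x) = m(T)·Σ_{y∈T(u)} f(y). -/

import Mathlib

/-! Basic definitions: matchings of a simple graph (as finite sets of edges),
maximum matchings, the number `m(T)` of maximum matchings, alternating paths,
the quantity `μ_T(u,v)`, and generalized inverses of real symmetric matrices. -/

variable {V : Type*}

/-- `M` is a matching of `G`: a finite set of edges of `G` that are pairwise
vertex-disjoint. -/
def IsMatching (G : SimpleGraph V) (M : Finset (Sym2 V)) : Prop :=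
  (∀ e ∈ M, e ∈ G.edgeSet) ∧
    ∀ e ∈ M, ∀ f ∈ M, e ≠ f → ∀ v : V, ¬(v ∈ e ∧ v ∈ f)

/-- `M` is a maximum matching of `G`: a matching of maximum cardinality. -/
def IsMaximumMatching (G : SimpleGraph V) (M : Finset (Sym2 V)) : Prop :=
  IsMatching G M ∧ ∀ M' : Finset (Sym2 V), IsMatching G M' → M'.card ≤ M.card

/-- `m(G)`: the number of maximum matchings of `G`. -/
noncomputable def numMaxMatchings (G : SimpleGraph V) : ℕ :=
  {M : Finset (Sym2 V) | IsMaximumMatching G M}.ncard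

/-- The matching `M` covers the vertex `v`. -/
def Covers (M : Finset (Sym2 V)) (v : V) : Prop := ∃ e ∈ M, v ∈ e

/-- A vertex `u` is saturated in `G` if every maximum matching of `G` covers it. -/
def Saturated (G : SimpleGraph V) (u : V) : Prop :=
  ∀ M : Finset (Sym2 V), IsMaximumMatching G M → Covers M u

/-- `p` is a `u_M v` alternating path: a path whose edges belong alternately to `M`
and not to `M`, with both the first and the last edge in `M` (equivalently, the
`i`-th edge lies in `M` iff `i` is even, and the length is odd). -/
def IsAltPath (G : SimpleGraph V) (M : Finset (Sym2 V)) {u v : V} (p : G.Walk u v) : Prop :=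
  p.IsPath ∧ Odd p.length ∧
    ∀ (i : ℕ) (h : i < p.edges.length), (p.edges.get ⟨i, h⟩ ∈ M ↔ Even i)

/-- There exists a `u_M v` alternating path in `G`. -/
def HasAltPath (G : SimpleGraph V) (M : Finset (Sym2 V)) (u v : V) : Prop :=
  ∃ p : G.Walk u v, IsAltPath G M p

/-- `μ_G(u,v)`: the sign `σ(u,v)` (which is `+1` if `dist(u,v) ≡ 1 (mod 4)` and `-1`
if `dist(u,v) ≡ 3 (mod 4)`) times the number of maximum matchings `M` of `G` admitting
a `u_M v` alternating path; it is `0` when no such maximum matching exists. -/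
noncomputable def muT (G : SimpleGraph V) (u v : V) : ℤ :=
  (if G.dist u v % 4 = 1 then 1 else -1) *
    ({M : Finset (Sym2 V) | IsMaximumMatching G M ∧ HasAltPath G M u v}.ncard : ℤ)

/-- `B` is the generalized inverse of the real symmetric matrix `A`: the (unique)
symmetric matrix `B` with `ABA = A`, `BAB = B` and `AB = BA`. -/
def IsGenInverse {n : Type*} [Fintype n] (A B : Matrix n n ℝ) : Prop :=
  B.IsSymm ∧ A * B * A = A ∧ B * A * B = B ∧ A * B = B * A

open SimpleGraph

def AltR (G : SimpleGraph V) (M : Finset (Sym2 V)) (u w : V) : Prop :=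
  ∃ p : G.Walk u w, p.IsPath ∧
    ∀ (i : ℕ) (h : i < p.edges.length), (p.edges.get ⟨i, h⟩ ∈ M ↔ Even i)

lemma tree_len {G : SimpleGraph V} (hT : G.IsTree) {u w : V} (p : G.Walk u w) (hp : p.IsPath) :
    p.length = G.dist u w := by
  obtain ⟨q, hq, hq'⟩ := hT.connected.exists_path_of_dist u w
  rw [← hq', (hT.existsUnique_path u w).unique hp hq]

lemma altR_self (G : SimpleGraph V) (M : Finset (Sym2 V)) (u : V) : AltR G M u u :=
  ⟨Walk.nil, by simp, by simp⟩

lemma hasAlt_iff {G : SimpleGraph V} (hT : G.IsTree) (M : Finset (Sym2 V)) (u w : V) :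
    HasAltPath G M u w ↔ AltR G M u w ∧ Odd (G.dist u w) := by
  constructor
  · rintro ⟨p, hp, ho, ha⟩
    exact ⟨⟨p, hp, ha⟩, by rw [← tree_len hT p hp]; exact ho⟩
  · rintro ⟨⟨p, hp, ha⟩, ho⟩
    exact ⟨p, hp, by rw [tree_len hT p hp]; exact ho, ha⟩

lemma altR_step {G : SimpleGraph V} (hT : G.IsTree) (M : Finset (Sym2 V)) {u w x : V}
    (h : G.Adj w x) (hd : G.dist u x = G.dist u w + 1) :
    AltR G M u x ↔ AltR G M u w ∧ (s(w, x) ∈ M ↔ Even (G.dist u w)) := by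
  have key : ∀ p : G.Walk u w, (∀ (i : ℕ) (hi : i < (p.concat h).edges.length),
      ((p.concat h).edges.get ⟨i, hi⟩ ∈ M ↔ Even i)) ↔
      (∀ (i : ℕ) (hi : i < p.edges.length), (p.edges.get ⟨i, hi⟩ ∈ M ↔ Even i)) ∧
      (s(w, x) ∈ M ↔ Even p.length) := by
    intro p
    simp only [Walk.edges_concat, List.concat_eq_append, List.get_eq_getElem,
      List.length_append, List.length_singleton]
    have hl := p.length_edges
    constructor
    · intro H
      constructor
      · intro i hi
        have := H i (by omega)
        rwa [List.getElem_append_left hi] at this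
      · have := H p.length (by omega)
        rw [List.getElem_append_right (by omega)] at this
        simpa [hl] using this
    · rintro ⟨H1, H2⟩ i hi
      by_cases hi' : i < p.edges.length
      · rw [List.getElem_append_left hi']; exact H1 i hi'
      · have : i = p.length := by omega
        subst this
        rw [List.getElem_append_right (by omega)]
        simpa using H2
  have pc : ∀ p : G.Walk u w, p.IsPath → (p.concat h).IsPath := by
    intro p hp
    apply Walk.isPath_of_length_eq_dist
    rw [Walk.length_concat, tree_len hT p hp, hd]
  constructor
  · rintro ⟨q, hq, ha⟩
    obtain ⟨p, hp, hp'⟩ := hT.connected.exists_path_of_dist u w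
    have : q = p.concat h := (hT.existsUnique_path u x).unique hq (pc p hp)
    subst this
    rw [key] at ha
    exact ⟨⟨p, hp, ha.1⟩, by rw [← hp']; exact ha.2⟩
  · rintro ⟨⟨p, hp, ha⟩, hb⟩
    exact ⟨p.concat h, pc p hp, (key p).2 ⟨ha, by rw [tree_len hT p hp]; exact hb⟩⟩

lemma parent_unique {G : SimpleGraph V} (hT : G.IsTree) {u w y x : V}
    (h : G.Adj w x) (hd : G.dist u x = G.dist u w + 1)
    (h' : G.Adj y x) (hd' : G.dist u x = G.dist u y + 1) : w = y := by
  obtain ⟨p, hp, hpl⟩ := hT.connected.exists_path_of_dist u w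
  obtain ⟨q, hq, hql⟩ := hT.connected.exists_path_of_dist u y
  have e : p.concat h = q.concat h' := by
    apply (hT.existsUnique_path u x).unique
    · apply Walk.isPath_of_length_eq_dist
      rw [Walk.length_concat, hpl, hd]
    · apply Walk.isPath_of_length_eq_dist
      rw [Walk.length_concat, hql, hd']
  have := congrArg Walk.penultimate e
  simpa using this

lemma parent_exists {G : SimpleGraph V} (hT : G.IsTree) {u x : V} (hx : G.dist u x ≠ 0) :
    ∃ y, G.Adj y x ∧ G.dist u x = G.dist u y + 1 := by
  obtain ⟨p, hp, hpl⟩ := hT.connected.exists_path_of_dist u x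
  have hn : ¬ p.Nil := by
    intro hn
    have := Walk.length_eq_zero_iff.2 hn
    omega
  refine ⟨p.penultimate, p.adj_penultimate hn, ?_⟩
  have h1 := tree_len hT _ hp.dropLast
  have h2 : p.dropLast.length + 1 = p.length := by
    rw [← Walk.length_concat _ (p.adj_penultimate hn), Walk.concat_dropLast]
  omega

lemma altR_congr {G : SimpleGraph V} (hT : G.IsTree) (M N : Finset (Sym2 V)) {u x : V}
    (hMN : ∀ e : Sym2 V, x ∉ e → (e ∈ M ↔ e ∈ N)) :
    ∀ (n : ℕ) (w : V), G.dist u w = n → n < G.dist u x → (AltR G M u w ↔ AltR G N u w) := by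
  intro n
  induction n with
  | zero =>
    intro w hw _
    rw [hT.connected.dist_eq_zero_iff] at hw
    subst hw
    simp [altR_self]
  | succ n ih =>
    intro w hw hx
    obtain ⟨y, hy, hyd⟩ := parent_exists hT (u := u) (x := w) (by omega)
    rw [altR_step hT M hy hyd, altR_step hT N hy hyd, ih y (by omega) (by omega),
      hMN s(y, w) ?_]
    simp only [Sym2.mem_iff, not_or]
    constructor <;> rintro rfl <;> omega

lemma match_unique {G : SimpleGraph V} {M : Finset (Sym2 V)} (hM : IsMatching G M) {a b c : V}
    (h1 : s(a, b) ∈ M) (h2 : s(a, c) ∈ M) : b = c := by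
  by_contra hne
  refine hM.2 _ h1 _ h2 ?_ a (by simp)
  intro h
  rcases Sym2.eq_iff.1 h with h | h
  · exact hne h.2
  · exact hne (h.2.trans h.1)

lemma altR_even_parent {G : SimpleGraph V} (hT : G.IsTree) {M : Finset (Sym2 V)}
    (hM : IsMatching G M) {u w y : V} (h : G.Adj y w) (hd : G.dist u w = G.dist u y + 1)
    (ho : Odd (G.dist u y)) (ha : AltR G M u y) : s(y, w) ∉ M := by
  intro hm
  obtain ⟨z, hz, hzd⟩ := parent_exists hT (u := u) (x := y) (by
    intro h0; rw [h0] at ho; simp at ho)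
  rw [altR_step hT M hz hzd] at ha
  have : Even (G.dist u z) := by
    rw [hzd] at ho; by_contra hne; rw [Nat.not_even_iff_odd] at hne; grind
  have h1 := ha.2.2 this
  rw [Sym2.eq_swap] at h1
  have := match_unique hM h1 hm
  subst this
  omega

open Classical in
noncomputable def ind (P : Prop) : ℝ := if P then 1 else 0

lemma ind_t {P : Prop} (h : P) : ind P = 1 := by simp [ind, h]
lemma ind_f {P : Prop} (h : ¬ P) : ind P = 0 := by simp [ind, h]
lemma ind_congr {P Q : Prop} (h : P ↔ Q) : ind P = ind Q := by rw [propext h]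

noncomputable def sg (n : ℕ) : ℝ := if n % 4 = 1 then 1 else -1
noncomputable def qs (n : ℕ) : ℝ := if n % 4 = 0 then 1 else -1

lemma sum_cov [Fintype V] {G : SimpleGraph V} [DecidableRel G.Adj]
    {M : Finset (Sym2 V)} (hM : IsMatching G M) (w : V) :
    ∑ v ∈ G.neighborFinset w, ind (s(w, v) ∈ M) = 1 - ind (¬ Covers M w) := by
  by_cases hc : Covers M w
  · rw [ind_f (by simpa using hc)]
    obtain ⟨e, he, hwe⟩ := hc
    obtain ⟨v, rfl⟩ := Sym2.mem_iff_exists.1 hwe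
    rw [Finset.sum_eq_single v]
    · rw [ind_t he]; simp
    · intro b _ hb
      exact ind_f fun h => hb (match_unique hM h he)
    · intro h
      exact absurd (by simpa using hM.1 _ he) (by simpa using h)
  · rw [ind_t hc, Finset.sum_eq_zero]
    · simp
    · intro v _
      exact ind_f fun h => hc ⟨_, h, by simp⟩

lemma sumA [Fintype V] {G : SimpleGraph V} [DecidableRel G.Adj] (hT : G.IsTree)
    {M : Finset (Sym2 V)} (hM : IsMatching G M) (u w : V) :
    ∑ v ∈ G.neighborFinset w, sg (G.dist u v) * ind (AltR G M u v ∧ Odd (G.dist u v)) =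
      ind (u = w) - qs (G.dist u w) *
        ind (AltR G M u w ∧ Even (G.dist u w) ∧ ¬ Covers M w) := by
  classical
  by_cases huw : u = w
  · subst huw
    have h0 : G.dist u u = 0 := by simp
    rw [ind_t rfl, ind_congr (Q := ¬ Covers M u) (by simp [altR_self]), h0]
    simp only [qs, Nat.zero_mod, if_true, one_mul]
    rw [← sum_cov hM u]
    apply Finset.sum_congr rfl
    intro v hv
    have hv : G.Adj u v := by simpa using hv
    have hd : G.dist u v = 1 := dist_eq_one_iff_adj.2 hv
    have := altR_step hT M (u := u) hv (by rw [hd, h0])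
    rw [ind_congr (Q := s(u,v) ∈ M) (by rw [this, hd, h0]; simp [altR_self]), hd]
    simp [sg]
  · rw [ind_f huw, zero_sub]
    have hd0 : G.dist u w ≠ 0 := by rwa [Ne, hT.connected.dist_eq_zero_iff]
    obtain ⟨y, hy, hyd⟩ := parent_exists hT hd0
    by_cases he : Even (G.dist u w)
    swap
    · rw [ind_f (by tauto), mul_zero, neg_zero]
      apply Finset.sum_eq_zero
      intro v hv
      have hv : G.Adj w v := by simpa using hv
      rw [ind_f, mul_zero]
      rintro ⟨-, ho⟩
      rcases hT.dist_eq_dist_add_one_of_adj u hv with h | h <;> grind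
    have hoy : Odd (G.dist u y) := by grind
    have hyw : y ∈ G.neighborFinset w := by simpa using hy.symm
    have hAw : AltR G M u w ↔ AltR G M u y := by
      rw [altR_step hT M hy hyd]
      constructor
      · exact fun h => h.1
      · intro h
        have h1 := altR_even_parent hT hM hy hyd hoy h
        exact ⟨h, by simp only [h1, false_iff]; simpa using hoy⟩
    have hsgy : sg (G.dist u y) = - qs (G.dist u w) := by
      rw [sg, qs, hyd]; grind
    rw [← Finset.add_sum_erase _ _ hyw]
    have hrest : ∀ v ∈ (G.neighborFinset w).erase y,
        sg (G.dist u v) * ind (AltR G M u v ∧ Odd (G.dist u v)) =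
        qs (G.dist u w) * (ind (AltR G M u w) * ind (s(w, v) ∈ M)) := by
      intro v hv
      obtain ⟨hvy, hv⟩ := Finset.mem_erase.1 hv
      have hv : G.Adj w v := by simpa using hv
      have hd : G.dist u v = G.dist u w + 1 := by
        rcases hT.dist_eq_dist_add_one_of_adj u hv with h | h
        · exact absurd (parent_unique hT hv.symm h hy hyd) hvy
        · exact h
      have hs : sg (G.dist u v) = qs (G.dist u w) := by
        rw [sg, qs, hd]; grind
      rw [hs, altR_step hT M hv hd]
      have ho : Odd (G.dist u v) := by grind
      congr 1
      by_cases h1 : AltR G M u w <;> by_cases h2 : s(w, v) ∈ M <;> simp [ind, h1, h2, ho, he]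
    rw [Finset.sum_congr rfl hrest, ← Finset.mul_sum, ← Finset.mul_sum]
    by_cases hA : AltR G M u w
    · have hAy := hAw.1 hA
      have hns := altR_even_parent hT hM hy hyd hoy hAy
      rw [Sym2.eq_swap] at hns
      have hc := sum_cov hM w
      rw [← Finset.add_sum_erase _ _ hyw, ind_f hns, zero_add] at hc
      rw [hc, ind_t hA, ind_t ⟨hAy, hoy⟩, hsgy,
        ind_congr (P := AltR G M u w ∧ _ ∧ _) (Q := ¬ Covers M w) (by tauto)]
      ring
    · rw [ind_f hA, ind_f (fun h => hA (hAw.2 h.1)), ind_f (fun h => hA h.1)]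
      ring

lemma swap_max {G : SimpleGraph V} [DecidableEq V] {M : Finset (Sym2 V)}
    (hM : IsMaximumMatching G M) {x w z : V} (hx : G.Adj x w) (hw : ¬ Covers M w)
    (hz : s(x, z) ∈ M) :
    IsMaximumMatching G (insert s(x, w) (M.erase s(x, z))) ∧
      ¬ Covers (insert s(x, w) (M.erase s(x, z))) z := by
  have hzw : z ≠ w := by
    rintro rfl
    exact hw ⟨_, hz, by simp⟩
  have hzx : z ≠ x := by
    rintro rfl
    have := hM.1.1 _ hz
    simp at this
  have hnm : s(x, w) ∉ M := fun h => hw ⟨_, h, by simp⟩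
  have hdis : ∀ e ∈ M.erase s(x, z), ∀ v, ¬ (v ∈ s(x, w) ∧ v ∈ e) := by
    rintro e he0 v ⟨h1, h2⟩
    obtain ⟨hne, he⟩ := Finset.mem_erase.1 he0
    rcases Sym2.mem_iff.1 h1 with rfl | rfl
    · exact hM.1.2 e he _ hz hne v ⟨h2, by simp⟩
    · exact hw ⟨e, he, h2⟩
  refine ⟨⟨⟨?_, ?_⟩, ?_⟩, ?_⟩
  · intro e he
    rcases Finset.mem_insert.1 he with rfl | he
    · exact hx
    · exact hM.1.1 e (Finset.mem_of_mem_erase he)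
  · intro e he f hf hef v hv
    rcases Finset.mem_insert.1 he with rfl | he
    · rcases Finset.mem_insert.1 hf with rfl | hf
      · exact hef rfl
      · exact hdis f hf v hv
    · rcases Finset.mem_insert.1 hf with rfl | hf
      · exact hdis e he v hv.symm
      · exact hM.1.2 e (Finset.mem_of_mem_erase he) f (Finset.mem_of_mem_erase hf) hef v hv
  · intro M' hM'
    rw [Finset.card_insert_of_notMem (fun h => hnm (Finset.mem_of_mem_erase h)),
      Finset.card_erase_add_one hz]
    exact hM.2 M' hM'
  · rintro ⟨e, he, hze⟩
    rcases Finset.mem_insert.1 he with rfl | he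
    · rcases Sym2.mem_iff.1 hze with h | h
      · exact hzx h
      · exact hzw h
    · obtain ⟨hne, he⟩ := Finset.mem_erase.1 he
      exact hM.1.2 e he _ hz hne z ⟨hze, by simp⟩

lemma cov_nbr {G : SimpleGraph V} {M : Finset (Sym2 V)}
    (hM : IsMaximumMatching G M) {x w : V} (hx : G.Adj x w) (hw : ¬ Covers M w) :
    ∃ z, s(x, z) ∈ M := by
  classical
  by_contra hcon
  have hc : ¬ Covers M x := by
    rintro ⟨e, he, hxe⟩
    obtain ⟨v, rfl⟩ := Sym2.mem_iff_exists.1 hxe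
    exact hcon ⟨v, he⟩
  have hnm : s(x, w) ∉ M := fun h => hw ⟨_, h, by simp⟩
  have hdis : ∀ e ∈ M, ∀ v, ¬ (v ∈ s(x, w) ∧ v ∈ e) := by
    rintro e he v ⟨h1, h2⟩
    rcases Sym2.mem_iff.1 h1 with rfl | rfl
    · exact hc ⟨e, he, h2⟩
    · exact hw ⟨e, he, h2⟩
  have := hM.2 (insert s(x, w) M) ⟨?_, ?_⟩
  · rw [Finset.card_insert_of_notMem hnm] at this
    omega
  · intro e he
    rcases Finset.mem_insert.1 he with rfl | he
    · exact hx
    · exact hM.1.1 e he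
  · intro e he f hf hef v hv
    rcases Finset.mem_insert.1 he with rfl | he
    · rcases Finset.mem_insert.1 hf with rfl | hf
      · exact hef rfl
      · exact hdis f hf v hv
    · rcases Finset.mem_insert.1 hf with rfl | hf
      · exact hdis e he v hv.symm
      · exact hM.1.2 e he f hf hef v hv

/-- the alternating property after a swap -/
lemma swap_alt {G : SimpleGraph V} [DecidableEq V] (hT : G.IsTree) {M : Finset (Sym2 V)}
    (hM : IsMaximumMatching G M) {u x w z : V} (hx : G.Adj x w) (hw : ¬ Covers M w)
    (hz : s(x, z) ∈ M) (hA : AltR G M u w) (he : Even (G.dist u w)) :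
    AltR G (insert s(x, w) (M.erase s(x, z))) u z ∧ Even (G.dist u z) ∧
      qs (G.dist u w) + qs (G.dist u z) = 0 := by
  have hzw : z ≠ w := by
    rintro rfl
    exact hw ⟨_, hz, by simp⟩
  have hxz : G.Adj x z := hM.1.1 _ hz
  have hnm : s(x, w) ∉ M := fun h => hw ⟨_, h, by simp⟩
  have hagree : ∀ e : Sym2 V, x ∉ e → (e ∈ M ↔ e ∈ insert s(x, w) (M.erase s(x, z))) := by
    intro e hxe
    have h1 : e ≠ s(x, w) := by rintro rfl; simp at hxe
    have h2 : e ≠ s(x, z) := by rintro rfl; simp at hxe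
    simp [h1, h2]
  rcases hT.dist_eq_dist_add_one_of_adj u hx with hd | hd
  · -- x is further than w
    have hdz : G.dist u z = G.dist u x + 1 := by
      rcases hT.dist_eq_dist_add_one_of_adj u hxz with h | h
      · exact absurd (parent_unique hT hxz.symm h hx.symm hd) hzw
      · exact h
    refine ⟨?_, by grind, by rw [qs, qs, hdz, hd]; grind⟩
    rw [altR_step hT _ hxz hdz, altR_step hT _ hx.symm hd,
      ← altR_congr hT M _ hagree _ w rfl (by omega)]
    refine ⟨⟨hA, ?_⟩, ?_⟩
    · simp [he, Sym2.eq_swap]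
    · have h1 : s(x, z) ≠ s(x, w) := by
        intro h
        rcases Sym2.eq_iff.1 h with h | h
        · exact hzw h.2
        · exact hzw (h.2.trans h.1)
      simp only [Finset.mem_insert, h1, Finset.mem_erase, ne_eq, not_true_eq_false, false_and,
        or_self, false_iff]
      grind
  · have hox : Odd (G.dist u x) := by grind
    obtain ⟨y, hy, hyd⟩ := parent_exists hT (u := u) (x := x) (by
      intro h0; rw [h0] at hox; simp at hox)
    rw [altR_step hT M hx hd, altR_step hT M hy hyd] at hA
    have hey : Even (G.dist u y) := by grind
    have hym := hA.1.2.2 hey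
    rw [Sym2.eq_swap] at hym
    obtain rfl := match_unique hM.1 hz hym
    refine ⟨?_, hey, by rw [qs, qs, hd, hyd]; grind⟩
    rw [← altR_congr hT M _ hagree _ z rfl (by omega)]
    exact hA.1.1

open Classical in
lemma sumQ [Fintype V] {G : SimpleGraph V} [DecidableRel G.Adj] (hT : G.IsTree)
    (S : Finset (Finset (Sym2 V))) (hS : ∀ M, M ∈ S ↔ IsMaximumMatching G M) (u x : V) :
    ∑ w ∈ G.neighborFinset x, ∑ M ∈ S, qs (G.dist u w) *
        ind (AltR G M u w ∧ Even (G.dist u w) ∧ ¬ Covers M w) = 0 := by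
  rw [← Finset.sum_product']
  have e : ∀ a : V × Finset (Sym2 V), qs (G.dist u a.1) *
        ind (AltR G a.2 u a.1 ∧ Even (G.dist u a.1) ∧ ¬ Covers a.2 a.1) =
      if (AltR G a.2 u a.1 ∧ Even (G.dist u a.1) ∧ ¬ Covers a.2 a.1)
      then qs (G.dist u a.1) else 0 := by
    intro a; simp [ind]
  rw [Finset.sum_congr rfl (fun a _ => e a), ← Finset.sum_filter]
  have hmem : ∀ a : V × Finset (Sym2 V), a ∈ ((G.neighborFinset x ×ˢ S).filter
      fun a => (AltR G a.2 u a.1 ∧ Even (G.dist u a.1) ∧ ¬ Covers a.2 a.1)) ↔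
      (G.Adj x a.1 ∧ IsMaximumMatching G a.2) ∧
        (AltR G a.2 u a.1 ∧ Even (G.dist u a.1) ∧ ¬ Covers a.2 a.1) := by
    intro a; simp [hS]
  have hex : ∀ a : V × Finset (Sym2 V), a ∈ ((G.neighborFinset x ×ˢ S).filter
      fun a => (AltR G a.2 u a.1 ∧ Even (G.dist u a.1) ∧ ¬ Covers a.2 a.1)) →
      ∃ z, s(x, z) ∈ a.2 := by
    intro a ha
    rw [hmem] at ha
    exact cov_nbr ha.1.2 ha.1.1 ha.2.2.2
  choose p hp using hex
  have hg : ∀ a ha, (p a ha, insert s(x, a.1) (a.2.erase s(x, p a ha))) ∈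
      ((G.neighborFinset x ×ˢ S).filter
      fun a => (AltR G a.2 u a.1 ∧ Even (G.dist u a.1) ∧ ¬ Covers a.2 a.1)) := by
    intro a ha
    have h := hp a ha
    have ha' := (hmem a).1 ha
    have h1 := swap_max ha'.1.2 ha'.1.1 ha'.2.2.2 h
    have h2 := swap_alt hT ha'.1.2 ha'.1.1 ha'.2.2.2 h ha'.2.1 ha'.2.2.1
    rw [hmem]
    exact ⟨⟨ha'.1.2.1.1 _ h, h1.1⟩, h2.1, h2.2.1, h1.2⟩
  refine Finset.sum_involution
    (fun a ha => (p a ha, insert s(x, a.1) (a.2.erase s(x, p a ha)))) ?_ ?_ hg ?_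
  · intro a ha
    have ha' := (hmem a).1 ha
    exact (swap_alt hT ha'.1.2 ha'.1.1 ha'.2.2.2 (hp a ha) ha'.2.1 ha'.2.2.1).2.2
  · intro a ha _ h
    have ha' := (hmem a).1 ha
    have h3 := hp a ha
    have h1 : p a ha = a.1 := congrArg Prod.fst h
    rw [h1] at h3
    exact ha'.2.2.2 ⟨_, h3, by simp⟩
  · intro a ha
    have ha' := (hmem a).1 ha
    have h3 := hp _ (hg a ha)
    have h4 := ((hmem _).1 (hg a ha)).1.2.1
    have h5 : p _ (hg a ha) = a.1 := match_unique h4 h3 (by simp)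
    have hnm : s(x, a.1) ∉ a.2 := fun h => ha'.2.2.2 ⟨_, h, by simp⟩
    have h6 := hp a ha
    refine Prod.ext h5 ?_
    change insert s(x, p a ha) (Finset.erase (insert s(x, a.1) (a.2.erase s(x, p a ha)))
      s(x, p _ (hg a ha))) = a.2
    rw [h5, Finset.erase_insert (fun h => hnm (Finset.mem_of_mem_erase h)),
      Finset.insert_erase h6]

/-- Let `T` be a tree with vertex set `V` and let `u` be an arbitrary vertex.
Then every function `f : V → ℝ` satisfies
`∑_{v∈V} μ_T(u,v) ∑_{w∈T(v)} ∑_{x∈T(w)} f(x) = m(T)·∑_{y∈T(u)} f(y)`. -/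
theorem stmt7 {V : Type*} [Fintype V] [DecidableEq V] (G : SimpleGraph V)
    [DecidableRel G.Adj] (hT : G.IsTree) (hV : 2 ≤ Fintype.card V)
    (u : V) (f : V → ℝ) :
    ∑ v : V, (muT G u v : ℝ) * ∑ w ∈ G.neighborFinset v, ∑ x ∈ G.neighborFinset w, f x
      = (numMaxMatchings G : ℝ) * ∑ y ∈ G.neighborFinset u, f y := by
  classical
  set S : Finset (Finset (Sym2 V)) := Finset.univ.filter (IsMaximumMatching G) with hSdef
  have hS : ∀ M, M ∈ S ↔ IsMaximumMatching G M := by intro M; simp [hSdef]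
  have hm : (numMaxMatchings G : ℝ) = ∑ M ∈ S, (1 : ℝ) := by
    rw [numMaxMatchings, Finset.sum_const, nsmul_eq_mul, mul_one]
    congr 1
    rw [← Set.ncard_coe_finset]
    congr 1
    ext M; simp [hS]
  have hmu : ∀ v, (muT G u v : ℝ) =
      ∑ M ∈ S, sg (G.dist u v) * ind (AltR G M u v ∧ Odd (G.dist u v)) := by
    intro v
    have h1 : ({M : Finset (Sym2 V) | IsMaximumMatching G M ∧ HasAltPath G M u v}.ncard : ℝ)
        = ∑ M ∈ S, ind (AltR G M u v ∧ Odd (G.dist u v)) := by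
      have h2 : ∀ M ∈ S, ind (AltR G M u v ∧ Odd (G.dist u v)) =
          if (AltR G M u v ∧ Odd (G.dist u v)) then 1 else 0 := fun M _ => by simp [ind]
      rw [Finset.sum_congr rfl h2, Finset.sum_boole]
      congr 1
      rw [← Set.ncard_coe_finset]
      congr 1
      ext M; simp [hS, hasAlt_iff hT]
    rw [← Finset.mul_sum, ← h1, muT, sg]
    push_cast
    rfl
  have hswap : ∀ a g : V → ℝ, ∑ v, a v * ∑ w ∈ G.neighborFinset v, g w =
      ∑ w, g w * ∑ v ∈ G.neighborFinset w, a v := by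
    intro a g
    simp only [Finset.mul_sum]
    rw [Finset.sum_comm' (t' := Finset.univ) (s' := fun w => G.neighborFinset w)]
    · simp only [mul_comm]
    · intro v w; simp [G.adj_comm]
  have hrow : ∀ w, ∑ v ∈ G.neighborFinset w, (muT G u v : ℝ) =
      (numMaxMatchings G : ℝ) * ind (u = w) - ∑ M ∈ S, qs (G.dist u w) *
        ind (AltR G M u w ∧ Even (G.dist u w) ∧ ¬ Covers M w) := by
    intro w
    simp only [hmu]
    rw [Finset.sum_comm, Finset.sum_congr rfl
      (fun M hM => sumA hT ((hS M).1 hM).1 u w), Finset.sum_sub_distrib, hm, Finset.sum_mul]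
    simp
  rw [hswap]
  simp only [hrow, mul_sub, Finset.sum_sub_distrib]
  have h0 : ∑ w, (∑ x ∈ G.neighborFinset w, f x) * ∑ M ∈ S, qs (G.dist u w) *
        ind (AltR G M u w ∧ Even (G.dist u w) ∧ ¬ Covers M w) = 0 := by
    rw [Finset.sum_congr rfl (fun w _ => mul_comm _ _), hswap]
    apply Finset.sum_eq_zero
    intro x _
    rw [sumQ hT S hS, mul_zero]
  rw [h0, sub_zero, Finset.sum_eq_single u]
  · rw [ind_t rfl]; ring
  · intro w _ hw
    rw [ind_f (Ne.symm hw)]; ring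
  · simp
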